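/- Let α > 0 and define Γ(ξ,τ) = G(ξ) - α² e^{-τ} ΔG(ξ) for ξ ∈ ℝ², τ ∈ ℝ, where G(ξ) = (1/(4π)) e^{-|ξ|²/4}. Then Γ satisfies the linear scaled vorticity equation: for all (ξ,τ), ∂_τ Γ(ξ,τ) = Δ_ξ Γ(ξ,τ) + (1/2) ξ·∇_ξ Γ(ξ,τ) + Γ(ξ,τ). -/

import Mathlib

open MeasureTheory Real ENNReal

noncomputable section

abbrev E2 := EuclideanSpace ℝ (Fin 2)

def e (i : Fin 2) : E2 := EuclideanSpace.single i 1

/-- Partial derivative in the `i`-th coordinate direction. -/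
def pd (i : Fin 2) (f : E2 → ℝ) (x : E2) : ℝ := fderiv ℝ f x (e i)

/-- The Laplacian on `ℝ²`. -/
def lap (f : E2 → ℝ) (x : E2) : ℝ := ∑ i : Fin 2, pd i (pd i f) x

/-- The Gaussian `G(ξ) = (1/4π) e^{-|ξ|²/4}`. -/
def G (ξ : E2) : ℝ := (4 * π)⁻¹ * Real.exp (-‖ξ‖ ^ 2 / 4)

/-- The un-filtered Oseen profile `Γ(ξ,τ) = G(ξ) - α² e^{-τ} ΔG(ξ)`. -/
def Γfn (α : ℝ) (ξ : E2) (τ : ℝ) : ℝ := G ξ - α ^ 2 * Real.exp (-τ) * lap G ξ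

lemma rad_fderiv {φ φ' : ℝ → ℝ} (h : ∀ s, HasDerivAt φ (φ' s) s) (y : E2) :
    HasFDerivAt (fun y : E2 => φ (‖y‖ ^ 2)) ((φ' (‖y‖ ^ 2)) • (2 • (innerSL ℝ y))) y :=
  (h _).comp_hasFDerivAt y (hasStrictFDerivAt_norm_sq y).hasFDerivAt

lemma rad_pd {φ φ' : ℝ → ℝ} (h : ∀ s, HasDerivAt φ (φ' s) s) (i : Fin 2) :
    pd i (fun y : E2 => φ (‖y‖ ^ 2)) = fun y => (2 * φ' (‖y‖ ^ 2)) * y i := by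
  funext y
  simp only [pd, (rad_fderiv h y).fderiv, e]
  simp [EuclideanSpace.inner_single_right]
  ring

lemma rad_lap {φ φ' φ'' : ℝ → ℝ} (h : ∀ s, HasDerivAt φ (φ' s) s)
    (h' : ∀ s, HasDerivAt φ' (φ'' s) s) (y : E2) :
    lap (fun y : E2 => φ (‖y‖ ^ 2)) y = 4 * φ'' (‖y‖ ^ 2) * ‖y‖ ^ 2 + 4 * φ' (‖y‖ ^ 2) := by
  have key : ∀ i, pd i (pd i (fun y : E2 => φ (‖y‖ ^ 2))) y
      = 4 * φ'' (‖y‖ ^ 2) * (y i) ^ 2 + 2 * φ' (‖y‖ ^ 2) := by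
    intro i
    rw [rad_pd h]
    have hc : HasFDerivAt (fun y : E2 => y i) (EuclideanSpace.proj i : E2 →L[ℝ] ℝ) y :=
      (EuclideanSpace.proj i : E2 →L[ℝ] ℝ).hasFDerivAt
    have := ((rad_fderiv h' y).const_mul 2).mul hc
    simp only [pd, e]
    erw [this.fderiv]
    simp [EuclideanSpace.inner_single_right]
    ring
  have hn : ‖y‖ ^ 2 = y 0 ^ 2 + y 1 ^ 2 := by
    simp [EuclideanSpace.norm_sq_eq, Fin.sum_univ_two]
  simp only [lap, key, Fin.sum_univ_two]
  rw [show 4 * φ'' (‖y‖ ^ 2) * ‖y‖ ^ 2 = 4 * φ'' (‖y‖ ^ 2) * (y 0 ^ 2 + y 1 ^ 2) by rw [← hn]]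
  ring

def ge (a b s : ℝ) : ℝ := (a + b * s) * Real.exp (-s / 4)

lemma ge_deriv (a b s : ℝ) : HasDerivAt (ge a b) (ge (b - a / 4) (-b / 4) s) s := by
  have h1 : HasDerivAt (fun s : ℝ => a + b * s) (b * 1) s :=
    ((hasDerivAt_id s).const_mul b).const_add a
  have h2 : HasDerivAt (fun s : ℝ => Real.exp (-s / 4)) (Real.exp (-s / 4) * (-1 / 4)) s :=
    (((hasDerivAt_id s).neg).div_const 4).exp
  refine (h1.mul h2).congr_deriv ?_
  simp only [ge]
  ring

lemma G_eq : G = fun y : E2 => ge (4 * π)⁻¹ 0 (‖y‖ ^ 2) := by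
  funext y
  simp [G, ge]

lemma lapG (y : E2) : lap G y = ge (-(4 * π)⁻¹) ((4 * π)⁻¹ / 4) (‖y‖ ^ 2) := by
  rw [G_eq, rad_lap (ge_deriv _ _) (ge_deriv _ _)]
  simp only [ge]
  ring

lemma Gam_eq (α τ : ℝ) : (fun y => Γfn α y τ) = fun y : E2 =>
    ge ((4 * π)⁻¹ * (1 + α ^ 2 * Real.exp (-τ)))
      (-((4 * π)⁻¹ * (α ^ 2 * Real.exp (-τ)) / 4)) (‖y‖ ^ 2) := by
  funext y
  rw [Γfn, lapG, G_eq]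
  simp only [ge]
  ring

/-- `Γ` solves the linear scaled vorticity equation `∂_τ Γ = ΔΓ + (1/2)ξ·∇Γ + Γ`. -/
theorem Gamma_solves_linear_scaled_equation (α : ℝ) (hα : 0 < α) (ξ : E2) (τ : ℝ) :
    deriv (fun s => Γfn α ξ s) τ
      = lap (fun y => Γfn α y τ) ξ + (1 / 2) * fderiv ℝ (fun y => Γfn α y τ) ξ ξ
          + Γfn α ξ τ := by
  have hd : HasDerivAt (fun s => Γfn α ξ s) (α ^ 2 * Real.exp (-τ) * lap G ξ) τ := by
    have h2 : HasDerivAt (fun s : ℝ => Real.exp (-s)) (Real.exp (-τ) * (-1)) τ :=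
      ((hasDerivAt_id τ).neg).exp
    refine (((h2.const_mul (α ^ 2)).mul_const (lap G ξ)).const_sub (G ξ)).congr_deriv ?_
    ring
  have hv : Γfn α ξ τ = _ := congrFun (Gam_eq α τ) ξ
  rw [hd.deriv, hv, Gam_eq, rad_lap (ge_deriv _ _) (ge_deriv _ _),
    (rad_fderiv (ge_deriv _ _) ξ).fderiv, lapG]
  simp only [ge, ContinuousLinearMap.smul_apply, innerSL_apply_apply,
    real_inner_self_eq_norm_sq, smul_eq_mul, nsmul_eq_mul]
  push_cast
  ring
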